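/- D ∈ A if and only if f⁻¹(U_branch) = Z(J), i.e., the preimage of the branch locus equals the ramification locus. -/

import Mathlib

noncomputable section

open MvPolynomial

/-- The multiplicity of `Q` in the factorization of `P` equals `e`. -/
def MultIs {σ : Type} (Q P : MvPolynomial σ ℂ) (e : ℕ) : Prop :=
  Q ^ e ∣ P ∧ ¬ Q ^ (e + 1) ∣ P

/-- The Jacobian `det (∂ f i / ∂ X j)` of an `n`-tuple of polynomials. -/
def Jac {n : ℕ} (f : Fin n → MvPolynomial (Fin n) ℂ) : MvPolynomial (Fin n) ℂ :=
  (Matrix.of fun i j : Fin n => pderiv j (f i)).det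

/-- `RamIdx A Q e` : the contraction `QB ∩ A` is generated by an irreducible `P ∈ A`,
and `e` is the multiplicity of `Q` in the factorization of `P` in `B`. -/
def RamIdx {σ : Type} (A : Subalgebra ℂ (MvPolynomial σ ℂ))
    (Q : MvPolynomial σ ℂ) (e : ℕ) : Prop :=
  ∃ P : A, Irreducible P ∧
    (Ideal.span {Q}).comap (algebraMap A (MvPolynomial σ ℂ)) = Ideal.span {P} ∧
    MultIs Q (P : MvPolynomial σ ℂ) e

/-- `Q` is a ramified irreducible of `B` over `A`. -/
def IsRamified {σ : Type} (A : Subalgebra ℂ (MvPolynomial σ ℂ))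
    (Q : MvPolynomial σ ℂ) : Prop :=
  Irreducible Q ∧ ∃ e, RamIdx A Q e ∧ 1 < e

/-- `RamReps A S e` : `S` is a finite set of pairwise non-associated irreducible elements of `B`,
each ramified with ramification index `e Q`, and every ramified irreducible of `B` is associated
to exactly one element of `S`. -/
def RamReps {σ : Type} (A : Subalgebra ℂ (MvPolynomial σ ℂ))
    (S : Finset (MvPolynomial σ ℂ)) (e : MvPolynomial σ ℂ → ℕ) : Prop :=
  (∀ Q ∈ S, Irreducible Q ∧ RamIdx A Q (e Q) ∧ 1 < e Q) ∧
  (∀ Q ∈ S, ∀ Q' ∈ S, Q ≠ Q' → ¬ Associated Q Q') ∧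
  (∀ Q : MvPolynomial σ ℂ, IsRamified A Q → ∃! Q', Q' ∈ S ∧ Associated Q Q')

/-- The polynomial map `ℂⁿ → ℂⁿ` associated to an `n`-tuple of polynomials. -/
def polyMap {n : ℕ} (f : Fin n → MvPolynomial (Fin n) ℂ) : (Fin n → ℂ) → (Fin n → ℂ) :=
  fun x i => eval x (f i)

/-- The branch locus: points whose fiber has fewer than `r` elements. -/
def branchLocus {n : ℕ} (f : Fin n → MvPolynomial (Fin n) ℂ) (r : ℕ) : Set (Fin n → ℂ) :=
  {u | (polyMap f ⁻¹' {u}).Finite ∧ (polyMap f ⁻¹' {u}).ncard < r}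

end

section

open MvPolynomial

/-- The derivation-like map `g ↦ ∑ j, φ (∂g/∂Xⱼ) * v j` along a ring homomorphism `φ`. -/
noncomputable def derivAlong {n : ℕ} {R : Type*} [CommRing R] (φ : MvPolynomial (Fin n) ℂ →+* R)
    (v : Fin n → R) : MvPolynomial (Fin n) ℂ →+ R where
  toFun g := ∑ j, φ (pderiv j g) * v j
  map_zero' := by simp
  map_add' g h := by simp [add_mul, Finset.sum_add_distrib]

section derivAlong

variable {n : ℕ} {R : Type*} [CommRing R] (φ : MvPolynomial (Fin n) ℂ →+* R) (v : Fin n → R)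

theorem derivAlong_apply (g : MvPolynomial (Fin n) ℂ) :
    derivAlong φ v g = ∑ j, φ (pderiv j g) * v j := rfl

@[simp]
theorem derivAlong_C (c : ℂ) : derivAlong φ v (C c) = 0 := by
  simp [derivAlong_apply]

@[simp]
theorem derivAlong_X (j : Fin n) : derivAlong φ v (X j) = v j := by
  simp [derivAlong_apply, pderiv_X, Pi.single_apply, apply_ite φ, ite_mul]

theorem derivAlong_mul (g h : MvPolynomial (Fin n) ℂ) :
    derivAlong φ v (g * h) = φ g * derivAlong φ v h + φ h * derivAlong φ v g := by
  simp only [derivAlong_apply, pderiv_mul, map_add, map_mul, Finset.mul_sum,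
    ← Finset.sum_add_distrib]
  exact Finset.sum_congr rfl fun j _ => by ring

theorem derivAlong_aeval {m : ℕ} (f : Fin m → MvPolynomial (Fin n) ℂ)
    (p : MvPolynomial (Fin m) ℂ) :
    derivAlong φ v (aeval f p) = ∑ i, φ (aeval f (pderiv i p)) * derivAlong φ v (f i) := by
  induction p using MvPolynomial.induction_on with
  | C c => simp [algebraMap_eq]
  | add p q hp hq => simp only [map_add, hp, hq, add_mul, Finset.sum_add_distrib]
  | mul_X p k hp =>
    simp only [map_mul, derivAlong_mul, hp, aeval_X, pderiv_mul, map_add, pderiv_X, add_mul,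
      Finset.sum_add_distrib, Pi.single_apply, Finset.mul_sum]
    rw [add_comm]
    congr 1
    · exact Finset.sum_congr rfl fun j _ => by ring
    · rw [Finset.sum_eq_single k]
      · simp
      · intro i _ hi
        simp [hi.symm]
      · simp

theorem derivAlong_eq_zero_of_mem_adjoin {s : Set (MvPolynomial (Fin n) ℂ)}
    (hs : ∀ g ∈ s, derivAlong φ v g = 0) {g : MvPolynomial (Fin n) ℂ}
    (hg : g ∈ Algebra.adjoin ℂ s) : derivAlong φ v g = 0 := by
  induction hg using Algebra.adjoin_induction with
  | mem g hg => exact hs g hg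
  | algebraMap c => exact derivAlong_C φ v c
  | add g h _ _ hg hh => rw [map_add, hg, hh, add_zero]
  | mul g h _ _ hg hh => rw [derivAlong_mul, hg, hh, mul_zero, mul_zero, add_zero]

theorem derivAlong_eq_mulVec (f : Fin n → MvPolynomial (Fin n) ℂ) (i : Fin n) :
    derivAlong φ v (f i) = ((Matrix.of fun i j : Fin n => pderiv j (f i)).map φ).mulVec v i := rfl

theorem map_Jac (f : Fin n → MvPolynomial (Fin n) ℂ) :
    φ (Jac f) = ((Matrix.of fun i j : Fin n => pderiv j (f i)).map φ).det := by
  rw [Jac, RingHom.map_det]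
  rfl

end derivAlong

/-! ### Fibres of the polynomial map -/

section fibre

variable {n : ℕ}

theorem exists_indicator_polynomial (T : Finset (Fin n → ℂ)) (y : Fin n → ℂ) :
    ∃ E : MvPolynomial (Fin n) ℂ, eval y E = 1 ∧ ∀ z ∈ T, z ≠ y → eval z E = 0 := by
  have key : ∀ z : Fin n → ℂ, z ≠ y →
      ∃ E : MvPolynomial (Fin n) ℂ, eval y E = 1 ∧ eval z E = 0 := by
    intro z hz
    obtain ⟨j, hj⟩ := Function.ne_iff.mp hz
    refine ⟨C (y j - z j)⁻¹ * (X j - C (z j)), ?_, by simp⟩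
    have : y j - z j ≠ 0 := sub_ne_zero.mpr (Ne.symm hj)
    simp [this]
  choose! E hE using key
  classical
  refine ⟨∏ z ∈ T.filter (· ≠ y), E z, ?_, fun z hz hzy => ?_⟩
  · rw [map_prod]
    exact Finset.prod_eq_one fun z hz => (hE z (Finset.mem_filter.mp hz).2).1
  · rw [map_prod]
    exact Finset.prod_eq_zero (Finset.mem_filter.mpr ⟨hz, hzy⟩) (hE z hzy).2

/-- Evaluation of polynomials at the points of a finite set. -/
noncomputable def evalOn (T : Finset (Fin n → ℂ)) : MvPolynomial (Fin n) ℂ →ₗ[ℂ] (T → ℂ) :=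
  LinearMap.pi fun y => (aeval (y : Fin n → ℂ)).toLinearMap

@[simp]
theorem evalOn_apply (T : Finset (Fin n → ℂ)) (g : MvPolynomial (Fin n) ℂ) (y : T) :
    evalOn T g y = eval (y : Fin n → ℂ) g := rfl

theorem evalOn_surjective (T : Finset (Fin n → ℂ)) : Function.Surjective (evalOn T) := by
  intro c
  choose E hE using exists_indicator_polynomial T
  refine ⟨∑ y : T, C (c y) * E y, funext fun z => ?_⟩
  rw [evalOn_apply, map_sum, Finset.sum_eq_single z]
  · simp [(hE z).1]
  · intro y _ hy
    simp [(hE y).2 z z.2 fun h => hy (Subtype.ext h.symm)]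
  · simp

theorem finrank_le_and_eq_iff_ker_le {K V U W : Type*} [Field K] [AddCommGroup V] [Module K V]
    [AddCommGroup U] [Module K U] [FiniteDimensional K U] [AddCommGroup W] [Module K W]
    (p : V →ₗ[K] U) (q : V →ₗ[K] W) (hp : Function.Surjective p) (hq : Function.Surjective q)
    (hpq : LinearMap.ker p ≤ LinearMap.ker q) :
    Module.finrank K W ≤ Module.finrank K U ∧
      (Module.finrank K W = Module.finrank K U ↔ LinearMap.ker q ≤ LinearMap.ker p) := by
  let e := p.quotKerEquivOfSurjective hp
  let g : U →ₗ[K] W := ((LinearMap.ker p).liftQ q hpq).comp e.symm.toLinearMap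
  have hg : ∀ x, g (p x) = q x := fun x => by
    have : e.symm (p x) = (LinearMap.ker p).mkQ x := by
      rw [LinearEquiv.symm_apply_eq]; rfl
    simp [g, this]
  have hgs : Function.Surjective g := fun w => by
    obtain ⟨x, rfl⟩ := hq w
    exact ⟨p x, hg x⟩
  have : FiniteDimensional K W := Module.Finite.of_surjective g hgs
  refine ⟨LinearMap.finrank_le_finrank_of_surjective hgs, fun h x hx => ?_, fun h => ?_⟩
  · have hinj : Function.Injective g :=
      (LinearMap.injective_iff_surjective_of_finrank_eq_finrank h.symm).mpr hgs
    rw [LinearMap.mem_ker] at hx ⊢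
    exact hinj (by rw [hg, hx, map_zero])
  · refine le_antisymm (LinearMap.finrank_le_finrank_of_surjective hgs)
      (LinearMap.finrank_le_finrank_of_injective (f := g) ?_)
    refine (injective_iff_map_eq_zero g).mpr fun u hu => ?_
    obtain ⟨x, rfl⟩ := hp u
    exact h (by rwa [hg] at hu)

/-- The ideal of the fibre of `f` through `x`. -/
noncomputable def fibreIdeal (f : Fin n → MvPolynomial (Fin n) ℂ) (x : Fin n → ℂ) :
    Ideal (MvPolynomial (Fin n) ℂ) :=
  Ideal.span (Set.range fun i => f i - C (eval x (f i)))

theorem zeroLocus_fibreIdeal (f : Fin n → MvPolynomial (Fin n) ℂ) (x : Fin n → ℂ) :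
    zeroLocus ℂ (fibreIdeal f x) = polyMap f ⁻¹' {polyMap f x} := by
  ext y
  simp [fibreIdeal, zeroLocus_span, polyMap, _root_.funext_iff, sub_eq_zero, aeval_eq_eval]

theorem sub_C_eval_mem_fibreIdeal (f : Fin n → MvPolynomial (Fin n) ℂ) (x : Fin n → ℂ)
    {g : MvPolynomial (Fin n) ℂ} (hg : g ∈ Algebra.adjoin ℂ (Set.range f)) :
    g - C (eval x g) ∈ fibreIdeal f x := by
  induction hg using Algebra.adjoin_induction with
  | mem g hg =>
    obtain ⟨i, rfl⟩ := hg
    exact Ideal.subset_span ⟨i, rfl⟩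
  | algebraMap c => simp [algebraMap_eq]
  | add g h _ _ hg hh =>
    have := add_mem hg hh
    simp only [map_add]
    convert this using 1
    ring
  | mul g h _ _ hg hh =>
    have := add_mem (Ideal.mul_mem_right h _ hg) (Ideal.mul_mem_left _ (C (eval x g)) hh)
    simp only [map_mul]
    convert this using 1
    ring

theorem exists_linearMap_ker_eq_fibreIdeal (f : Fin n → MvPolynomial (Fin n) ℂ)
    (A : Subalgebra ℂ (MvPolynomial (Fin n) ℂ)) (hA : A = Algebra.adjoin ℂ (Set.range f))
    [Module.Finite A (MvPolynomial (Fin n) ℂ)] [Module.Free A (MvPolynomial (Fin n) ℂ)]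
    (x : Fin n → ℂ) :
    ∃ p : MvPolynomial (Fin n) ℂ →ₗ[ℂ]
        (Fin (Module.finrank A (MvPolynomial (Fin n) ℂ)) → ℂ),
      Function.Surjective p ∧ ∀ g, g ∈ LinearMap.ker p ↔ g ∈ fibreIdeal f x := by
  let e := Module.finBasis A (MvPolynomial (Fin n) ℂ)
  let φ : A →ₐ[ℂ] ℂ := (aeval x).comp A.val
  have hφ : ∀ a : A, φ a = eval x (a : MvPolynomial (Fin n) ℂ) := fun a => rfl
  let p : MvPolynomial (Fin n) ℂ →ₗ[ℂ]
      (Fin (Module.finrank A (MvPolynomial (Fin n) ℂ)) → ℂ) :=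
    LinearMap.pi fun k => φ.toLinearMap.comp ((e.coord k).restrictScalars ℂ)
  have hp : ∀ g k, p g k = φ (e.repr g k) := fun g k => rfl
  refine ⟨p, fun c => ⟨∑ k, algebraMap ℂ A (c k) • e k, funext fun k => ?_⟩, fun g => ⟨?_, ?_⟩⟩
  · rw [hp, e.repr_sum_self, AlgHom.commutes]
    rfl
  · intro hg
    rw [← e.sum_repr g]
    refine sum_mem fun k _ => ?_
    have h0 : φ (e.repr g k) = 0 := by rw [← hp, LinearMap.mem_ker.mp hg]; rfl
    have := sub_C_eval_mem_fibreIdeal f x (g := (e.repr g k : MvPolynomial (Fin n) ℂ))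
      (hA.le (e.repr g k).2)
    rw [← hφ, h0, map_zero, sub_zero] at this
    rw [Algebra.smul_def]
    exact Ideal.mul_mem_right _ _ this
  · intro hg
    obtain ⟨c, rfl⟩ := Ideal.mem_span_range_iff_exists_fun.mp hg
    refine sum_mem fun i _ => LinearMap.mem_ker.mpr (funext fun k => ?_)
    have hmem : f i - C (eval x (f i)) ∈ A := by
      rw [hA]
      exact sub_mem (Algebra.subset_adjoin ⟨i, rfl⟩) (Subalgebra.algebraMap_mem _ _)
    have hsmul : c i * (f i - C (eval x (f i))) =
        (⟨f i - C (eval x (f i)), hmem⟩ : A) • c i := by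
      rw [Algebra.smul_def, mul_comm]
      rfl
    rw [hp, hsmul, map_smul, Finsupp.smul_apply, smul_eq_mul, map_mul, hφ]
    simp

theorem fibre_finite_and_ncard (f : Fin n → MvPolynomial (Fin n) ℂ)
    (A : Subalgebra ℂ (MvPolynomial (Fin n) ℂ)) (hA : A = Algebra.adjoin ℂ (Set.range f))
    [Module.Finite A (MvPolynomial (Fin n) ℂ)] [Module.Free A (MvPolynomial (Fin n) ℂ)]
    (x : Fin n → ℂ) :
    (polyMap f ⁻¹' {polyMap f x}).Finite ∧
      (polyMap f ⁻¹' {polyMap f x}).ncard ≤ Module.finrank A (MvPolynomial (Fin n) ℂ) ∧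
      ((polyMap f ⁻¹' {polyMap f x}).ncard = Module.finrank A (MvPolynomial (Fin n) ℂ) ↔
        (fibreIdeal f x).radical ≤ fibreIdeal f x) := by
  obtain ⟨p, hp, hker⟩ := exists_linearMap_ker_eq_fibreIdeal f A hA x
  have main : ∀ T : Finset (Fin n → ℂ), (T : Set (Fin n → ℂ)) ⊆ polyMap f ⁻¹' {polyMap f x} →
      LinearMap.ker p ≤ LinearMap.ker (evalOn T) := by
    intro T hT g hg
    rw [LinearMap.mem_ker]
    funext y
    have hy := hT y.2
    rw [← zeroLocus_fibreIdeal] at hy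
    exact hy g ((hker g).mp hg)
  have hfin : (polyMap f ⁻¹' {polyMap f x}).Finite := by
    by_contra hinf
    obtain ⟨T, hT, hcard⟩ := Set.Infinite.exists_subset_card_eq hinf
      (Module.finrank A (MvPolynomial (Fin n) ℂ) + 1)
    have := (finrank_le_and_eq_iff_ker_le p (evalOn T) hp (evalOn_surjective T) (main T hT)).1
    simp [hcard] at this
  obtain ⟨h1, h2⟩ := finrank_le_and_eq_iff_ker_le p (evalOn hfin.toFinset) hp
    (evalOn_surjective _) (main _ (by simp))
  have hrk : Module.finrank ℂ (hfin.toFinset → ℂ) = (polyMap f ⁻¹' {polyMap f x}).ncard := by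
    rw [Module.finrank_fintype_fun_eq_card, Fintype.card_coe, Set.ncard_eq_toFinset_card _ hfin]
  rw [hrk, Module.finrank_fin_fun] at h1 h2
  refine ⟨hfin, h1, h2.trans ?_⟩
  rw [← vanishingIdeal_zeroLocus_eq_radical (K := ℂ), zeroLocus_fibreIdeal]
  refine forall_congr' fun g => ?_
  rw [hker, LinearMap.mem_ker, mem_vanishingIdeal_iff]
  refine imp_congr_left ⟨fun h y hy => ?_, fun h => funext fun y => ?_⟩
  · exact congrFun h ⟨y, hfin.mem_toFinset.mpr hy⟩
  · exact h y (hfin.mem_toFinset.mp y.2)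

/-- The first-order Taylor expansion of a polynomial at a point. -/
theorem sub_taylor_mem_ker_eval_sq (y : Fin n → ℂ) (g : MvPolynomial (Fin n) ℂ) :
    g - C (eval y g) - ∑ j, C (eval y (pderiv j g)) * (X j - C (y j)) ∈
      RingHom.ker (eval y) ^ 2 := by
  induction g using MvPolynomial.induction_on with
  | C c => simp
  | add p q hp hq =>
    have := add_mem hp hq
    simp only [map_add, add_mul, Finset.sum_add_distrib]
    convert this using 1
    ring
  | mul_X p k hp =>
    have h1 : (p - C (eval y p)) * (X k - C (y k)) ∈ RingHom.ker (eval y) ^ 2 := by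
      rw [pow_two]
      exact Ideal.mul_mem_mul (by simp [RingHom.mem_ker]) (by simp [RingHom.mem_ker])
    have := add_mem (Ideal.mul_mem_left _ (C (y k)) hp) h1
    have hsum : ∑ j, C (eval y (pderiv j (p * X k))) * (X j - C (y j)) =
        C (y k) * ∑ j, C (eval y (pderiv j p)) * (X j - C (y j)) +
          C (eval y p) * (X k - C (y k)) := by
      simp only [pderiv_mul, map_add, map_mul, eval_X, pderiv_X, add_mul, Finset.sum_add_distrib,
        Finset.mul_sum]
      congr 1
      · exact Finset.sum_congr rfl fun j _ => by ring
      · rw [Finset.sum_eq_single k]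
        · simp
        · intro i _ hi
          simp [hi.symm]
        · simp
    rw [hsum]
    convert this using 1
    simp only [map_mul, eval_X]
    ring

theorem ker_eval_le_sq_sup_fibreIdeal {f : Fin n → MvPolynomial (Fin n) ℂ} {x y : Fin n → ℂ}
    (hxy : polyMap f y = polyMap f x) (hJ : eval y (Jac f) ≠ 0) :
    RingHom.ker (eval y) ≤ RingHom.ker (eval y) ^ 2 ⊔ fibreIdeal f x := by
  set I := RingHom.ker (eval y) ^ 2 ⊔ fibreIdeal f x with hI
  set M : Matrix (Fin n) (Fin n) ℂ :=
    (Matrix.of fun i j : Fin n => pderiv j (f i)).map (eval y) with hM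
  have hdet : IsUnit M.det := by
    rw [map_Jac (eval y)] at hJ
    exact isUnit_iff_ne_zero.mpr hJ
  have hrow : ∀ i, ∑ j, C (M i j) * (X j - C (y j)) ∈ I := by
    intro i
    have h1 := Ideal.mem_sup_left (T := fibreIdeal f x) (sub_taylor_mem_ker_eval_sq y (f i))
    have h2 : f i - C (eval y (f i)) ∈ I := by
      have : eval y (f i) = eval x (f i) := congrFun hxy i
      rw [this]
      exact Ideal.mem_sup_right (Ideal.subset_span ⟨i, rfl⟩)
    have := sub_mem h2 h1
    rwa [sub_sub_cancel] at this
  have hvar : ∀ k, X k - C (y k) ∈ I := by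
    intro k
    have h := sum_mem fun i (_ : i ∈ Finset.univ) => Ideal.mul_mem_left I (C (M⁻¹ k i)) (hrow i)
    have heq : ∑ i, C (M⁻¹ k i) * ∑ j, C (M i j) * (X j - C (y j)) = X k - C (y k) := by
      simp only [Finset.mul_sum, ← mul_assoc, ← map_mul]
      rw [Finset.sum_comm]
      simp only [← Finset.sum_mul, ← map_sum, ← Matrix.mul_apply]
      rw [Matrix.nonsing_inv_mul M hdet]
      simp [Matrix.one_apply, apply_ite, ite_mul]
    rwa [heq] at h
  intro g hg
  have h1 := Ideal.mem_sup_left (T := fibreIdeal f x) (sub_taylor_mem_ker_eval_sq y g)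
  rw [RingHom.mem_ker.mp hg, map_zero, sub_zero] at h1
  have h2 : ∑ j, C (eval y (pderiv j g)) * (X j - C (y j)) ∈ I :=
    sum_mem fun j _ => Ideal.mul_mem_left _ _ (hvar j)
  simpa using add_mem h1 h2

theorem Ideal.le_of_le_sq_sup {R : Type*} [CommRing R] {K I : Ideal R} (h : K ≤ K ^ 2 ⊔ I)
    {k : ℕ} (hk : K ^ k ≤ I) : K ≤ I := by
  have key : ∀ m, K ≤ K ^ (m + 1) ⊔ I := by
    intro m
    induction m with
    | zero => simp
    | succ m ih =>
      refine h.trans (sup_le ?_ le_sup_right)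
      rw [pow_two]
      refine (Ideal.mul_mono_right ih).trans ?_
      rw [Ideal.mul_sup, ← pow_succ']
      exact sup_le_sup_left Ideal.mul_le_right _
  exact (key k).trans (sup_le ((Ideal.pow_le_pow_right k.le_succ).trans hk) le_rfl)

theorem radical_fibreIdeal_le {f : Fin n → MvPolynomial (Fin n) ℂ} {x : Fin n → ℂ}
    (hfin : (polyMap f ⁻¹' {polyMap f x}).Finite)
    (hJ : ∀ y, polyMap f y = polyMap f x → eval y (Jac f) ≠ 0) :
    (fibreIdeal f x).radical ≤ fibreIdeal f x := by
  set I := fibreIdeal f x with hI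
  set T := hfin.toFinset with hT
  obtain ⟨k, hk⟩ := I.exists_radical_pow_le_of_fg (IsNoetherian.noetherian _)
  refine Ideal.le_of_le_sq_sup ?_ hk
  have hcop : ∀ y ∈ T, ∀ z ∈ T, y ≠ z →
      IsCoprime (RingHom.ker (eval y)) (RingHom.ker (eval z)) := by
    intro y _ z _ hyz
    obtain ⟨E, hE, hE'⟩ := exists_indicator_polynomial {z} y
    rw [Ideal.isCoprime_iff_exists]
    exact ⟨1 - E, by simp [RingHom.mem_ker, hE], E, hE' z (by simp) hyz.symm, by ring⟩
  have hrad : I.radical = ∏ y ∈ T, RingHom.ker (eval y) := by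
    rw [Ideal.prod_eq_iInf_of_pairwise_isCoprime hcop,
      ← vanishingIdeal_zeroLocus_eq_radical (K := ℂ), zeroLocus_fibreIdeal]
    ext g
    simp only [mem_vanishingIdeal_iff, Ideal.mem_iInf, RingHom.mem_ker, hT,
      Set.Finite.mem_toFinset]
    rfl
  have hprod : ∀ U ⊆ T, ∏ y ∈ U, RingHom.ker (eval y) ≤
      (∏ y ∈ U, RingHom.ker (eval y)) ^ 2 ⊔ I := by
    classical
    intro U
    induction U using Finset.induction_on with
    | empty => simp [-Ideal.one_eq_top]
    | insert y U hy ih =>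
      intro hU
      have hyT : polyMap f y = polyMap f x := by
        simpa [hT] using hU (Finset.mem_insert_self y U)
      rw [Finset.prod_insert hy, mul_pow]
      refine (Ideal.mul_mono (ker_eval_le_sq_sup_fibreIdeal hyT (hJ y hyT))
        (ih ((Finset.subset_insert y U).trans hU))).trans ?_
      rw [Ideal.sup_mul, Ideal.mul_sup]
      exact sup_le (sup_le_sup_left Ideal.mul_le_right _)
        (Ideal.mul_le_left.trans le_sup_right)
  rw [hrad]
  exact hprod T subset_rfl

theorem eval_Jac_ne_zero_of_radical_le {f : Fin n → MvPolynomial (Fin n) ℂ} {x : Fin n → ℂ}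
    (hfin : (polyMap f ⁻¹' {polyMap f x}).Finite)
    (hrad : (fibreIdeal f x).radical ≤ fibreIdeal f x) {y : Fin n → ℂ}
    (hy : polyMap f y = polyMap f x) : eval y (Jac f) ≠ 0 := by
  intro hJ
  rw [map_Jac (eval y)] at hJ
  obtain ⟨v, hv, hMv⟩ := Matrix.exists_mulVec_eq_zero_iff.mpr hJ
  apply hv
  obtain ⟨E, hE, hE'⟩ := exists_indicator_polynomial hfin.toFinset y
  have hvan : ∀ g ∈ fibreIdeal f x, eval y g = 0 := fun g hg => by
    have : y ∈ zeroLocus ℂ (fibreIdeal f x) := by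
      rw [zeroLocus_fibreIdeal]
      exact hy
    exact this g hg
  have hder : ∀ g ∈ fibreIdeal f x, derivAlong (eval y) v g = 0 := by
    intro g hg
    obtain ⟨c, rfl⟩ := Ideal.mem_span_range_iff_exists_fun.mp hg
    rw [map_sum]
    refine Finset.sum_eq_zero fun i _ => ?_
    rw [derivAlong_mul, map_sub, derivAlong_eq_mulVec, hMv,
      hvan _ (Ideal.subset_span ⟨i, rfl⟩)]
    simp
  funext j
  have hmem : E * (X j - C (y j)) ∈ fibreIdeal f x := by
    apply hrad
    rw [← vanishingIdeal_zeroLocus_eq_radical (K := ℂ), zeroLocus_fibreIdeal,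
      mem_vanishingIdeal_iff]
    intro z hz
    by_cases hzy : z = y
    · simp [hzy, aeval_eq_eval]
    · have := hE' z (hfin.mem_toFinset.mpr hz) hzy
      simp [aeval_eq_eval, this]
  simpa [derivAlong_mul, hE] using hder _ hmem

theorem preimage_branchLocus (f : Fin n → MvPolynomial (Fin n) ℂ)
    (A : Subalgebra ℂ (MvPolynomial (Fin n) ℂ)) (hA : A = Algebra.adjoin ℂ (Set.range f))
    [Module.Finite A (MvPolynomial (Fin n) ℂ)] [Module.Free A (MvPolynomial (Fin n) ℂ)]
    (x : Fin n → ℂ) :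
    x ∈ polyMap f ⁻¹' branchLocus f (Module.finrank A (MvPolynomial (Fin n) ℂ)) ↔
      ∃ y, polyMap f y = polyMap f x ∧ eval y (Jac f) = 0 := by
  obtain ⟨hfin, hle, heq⟩ := fibre_finite_and_ncard f A hA x
  have : x ∈ polyMap f ⁻¹' branchLocus f (Module.finrank A (MvPolynomial (Fin n) ℂ)) ↔
      ¬ (fibreIdeal f x).radical ≤ fibreIdeal f x := by
    rw [← heq, ← ne_eq, ← hle.lt_iff_ne]
    exact and_iff_right hfin
  rw [this, not_iff_comm]
  push Not
  exact ⟨fun h => radical_fibreIdeal_le hfin h, fun h y => eval_Jac_ne_zero_of_radical_le hfin h⟩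

end fibre

/-! ### Ramification and the Jacobian -/

section ramification

theorem eq_C_of_dvd_pderiv {σ : Type*} {p : MvPolynomial σ ℂ}
    (h : ∀ i, p ∣ pderiv i p) : p = C (coeff 0 p) := by
  have hzero : ∀ i, pderiv i p = 0 := by
    intro i
    by_contra hne
    obtain ⟨q, hq⟩ := h i
    have hp0 : p ≠ 0 := by
      rintro rfl
      simp at hne
    have hq0 : q ≠ 0 := by
      rintro rfl
      simp [hq] at hne
    have hdeg := totalDegree_mul_of_isDomain hp0 hq0
    rw [← hq] at hdeg
    obtain ⟨m, hm, hmdeg⟩ := Finset.exists_mem_eq_sup (pderiv i p).support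
      (support_nonempty.mpr hne) (fun s => s.sum fun _ e => e)
    have hmem : m + Finsupp.single i 1 ∈ p.support := by
      rw [mem_support_iff, coeff_pderiv] at hm
      exact mem_support_iff.mpr (left_ne_zero_of_mul hm)
    have hle := le_totalDegree hmem
    rw [Finsupp.sum_add_index' (fun _ => rfl) (fun _ _ _ => rfl),
      Finsupp.sum_single_index rfl] at hle
    change (pderiv i p).totalDegree = _ at hmdeg
    omega
  classical
  ext s
  by_cases hs : s = 0
  · simp [hs]
  obtain ⟨i, hi⟩ := Finsupp.ne_iff.mp hs
  have hsi : s - Finsupp.single i 1 + Finsupp.single i 1 = s :=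
    tsub_add_cancel_of_le (Finsupp.single_le_iff.mpr (Nat.one_le_iff_ne_zero.mpr hi))
  have hc := coeff_pderiv (i := i) p (s - Finsupp.single i 1)
  rw [hzero i, coeff_zero, hsi] at hc
  rw [coeff_C, if_neg (Ne.symm hs)]
  exact (mul_eq_zero.mp hc.symm).resolve_right (Nat.cast_add_one_ne_zero _)

theorem exists_multIs {σ : Type} {Q P : MvPolynomial σ ℂ} (hQ : Irreducible Q) (hP : P ≠ 0) :
    ∃ e, MultIs Q P e := by
  have hfin : FiniteMultiplicity Q P := .of_not_isUnit hQ.not_isUnit hP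
  exact ⟨multiplicity Q P, pow_multiplicity_dvd Q P,
    hfin.not_pow_dvd_of_multiplicity_lt (Nat.lt_succ_self _)⟩

variable {n : ℕ} {f : Fin n → MvPolynomial (Fin n) ℂ}
  {A : Subalgebra ℂ (MvPolynomial (Fin n) ℂ)}

theorem algebraicIndependent_of_finite_adjoin (hA : A = Algebra.adjoin ℂ (Set.range f))
    [Module.Finite A (MvPolynomial (Fin n) ℂ)] : AlgebraicIndependent ℂ f := by
  subst hA
  have : Algebra.IsIntegral (Algebra.adjoin ℂ (Set.range f)) (MvPolynomial (Fin n) ℂ) :=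
    Algebra.IsIntegral.of_finite _ _
  exact (Algebra.IsAlgebraic.isTranscendenceBasis_of_lift_le_trdeg_of_finite ℂ f
    (by rw [MvPolynomial.trdeg_of_isDomain]; simp)).1

theorem uniqueFactorizationMonoid_of_finite_adjoin (hA : A = Algebra.adjoin ℂ (Set.range f))
    [Module.Finite A (MvPolynomial (Fin n) ℂ)] : UniqueFactorizationMonoid A := by
  have h := algebraicIndependent_of_finite_adjoin hA
  subst hA
  exact h.aevalEquiv.toMulEquiv.uniqueFactorizationMonoid inferInstance

theorem exists_aeval_eq_of_mem (hA : A = Algebra.adjoin ℂ (Set.range f)) (a : A) :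
    ∃ p : MvPolynomial (Fin n) ℂ, aeval f p = (a : MvPolynomial (Fin n) ℂ) := by
  have h := hA.le a.2
  rw [Algebra.adjoin_range_eq_range_aeval] at h
  exact h

theorem mk_span_singleton_eq_zero_iff {R : Type*} [CommRing R] {Q g : R} :
    Ideal.Quotient.mk (Ideal.span {Q}) g = 0 ↔ Q ∣ g := by
  rw [Ideal.Quotient.eq_zero_iff_mem, Ideal.mem_span_singleton]

theorem mem_comap_span_singleton {Q : MvPolynomial (Fin n) ℂ} {a : A} :
    a ∈ (Ideal.span {Q}).comap (algebraMap A (MvPolynomial (Fin n) ℂ)) ↔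
      Q ∣ (a : MvPolynomial (Fin n) ℂ) := by
  rw [Ideal.mem_comap, Ideal.mem_span_singleton]
  rfl

theorem comap_span_eq_span_of_dvd [Module.Free A (MvPolynomial (Fin n) ℂ)]
    {Q : MvPolynomial (Fin n) ℂ} (hQ : Irreducible Q) {P : A} (hP : Prime P)
    (hdvd : Q ∣ (P : MvPolynomial (Fin n) ℂ)) :
    (Ideal.span {Q}).comap (algebraMap A (MvPolynomial (Fin n) ℂ)) = Ideal.span {P} := by
  have hQI : (Ideal.span {Q}).IsPrime :=
    (Ideal.span_singleton_prime hQ.ne_zero).mpr hQ.prime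
  have hPI : (Ideal.span {P}).IsPrime := (Ideal.span_singleton_prime hP.ne_zero).mpr hP
  have hle : Ideal.span {P} ≤ (Ideal.span {Q}).under A := by
    rw [Ideal.span_singleton_le_iff_mem]
    exact mem_comap_span_singleton.mpr hdvd
  obtain ⟨q, hqQ, hq, hqP⟩ := Ideal.exists_ideal_le_liesOver_of_le (Ideal.span {Q}) hle
  have hq0 : q ≠ ⊥ := by
    rintro rfl
    have : (algebraMap A (MvPolynomial (Fin n) ℂ)) P ∈
        (⊥ : Ideal (MvPolynomial (Fin n) ℂ)) :=
      (Ideal.mem_of_liesOver _ (Ideal.span {P}) P).mp (Ideal.mem_span_singleton_self P)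
    exact hP.ne_zero (Subtype.ext this)
  obtain ⟨g, hg, hgp⟩ := hq.exists_mem_prime_of_ne_bot hq0
  have hQg : Associated Q g :=
    hQ.associated_of_dvd hgp.irreducible (Ideal.mem_span_singleton.mp (hqQ hg))
  have hqeq : q = Ideal.span {Q} := le_antisymm hqQ <| by
    rw [Ideal.span_singleton_le_iff_mem]
    exact Ideal.mem_of_dvd _ hQg.symm.dvd hg
  rw [hqP.over, hqeq]

theorem exists_ramIdx (hA : A = Algebra.adjoin ℂ (Set.range f))
    [Module.Finite A (MvPolynomial (Fin n) ℂ)] [Module.Free A (MvPolynomial (Fin n) ℂ)]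
    {Q : MvPolynomial (Fin n) ℂ}
    (hQ : Irreducible Q) : ∃ e, RamIdx A Q e := by
  have := uniqueFactorizationMonoid_of_finite_adjoin hA
  have hQI : (Ideal.span {Q}).IsPrime :=
    (Ideal.span_singleton_prime hQ.ne_zero).mpr hQ.prime
  have hne : (Ideal.span {Q}).comap (algebraMap A (MvPolynomial (Fin n) ℂ)) ≠ ⊥ :=
    Ideal.comap_ne_bot_of_integral_mem hQ.ne_zero (Ideal.mem_span_singleton_self Q)
      (Algebra.IsIntegral.isIntegral Q)
  obtain ⟨P, hPmem, hP⟩ := Ideal.IsPrime.exists_mem_prime_of_ne_bot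
    (Ideal.comap_isPrime (algebraMap A (MvPolynomial (Fin n) ℂ)) (Ideal.span {Q})) hne
  obtain ⟨e, he⟩ := exists_multIs (P := (P : MvPolynomial (Fin n) ℂ)) hQ
    fun h => hP.ne_zero (Subtype.ext h)
  exact ⟨e, P, hP.irreducible,
    comap_span_eq_span_of_dvd hQ hP (mem_comap_span_singleton.mp hPmem), he⟩

theorem dvd_Jac_of_sq_dvd (hA : A = Algebra.adjoin ℂ (Set.range f))
    [Module.Finite A (MvPolynomial (Fin n) ℂ)]
    {Q : MvPolynomial (Fin n) ℂ} (hQ : Irreducible Q) {P : A} (hP : Irreducible P)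
    (hcomap : (Ideal.span {Q}).comap (algebraMap A (MvPolynomial (Fin n) ℂ)) = Ideal.span {P})
    (hdvd : Q ^ 2 ∣ (P : MvPolynomial (Fin n) ℂ)) : Q ∣ Jac f := by
  by_contra hJ
  have hf := algebraicIndependent_of_finite_adjoin hA
  have hQI : (Ideal.span {Q}).IsPrime :=
    (Ideal.span_singleton_prime hQ.ne_zero).mpr hQ.prime
  rw [← mk_span_singleton_eq_zero_iff, map_Jac] at hJ
  obtain ⟨p, hp⟩ := exists_aeval_eq_of_mem hA P
  have hw : (fun i => Ideal.Quotient.mk (Ideal.span {Q}) (aeval f (pderiv i p))) = 0 := by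
    by_contra hw
    refine hJ (Matrix.exists_vecMul_eq_zero_iff.mp ⟨_, hw, funext fun j => ?_⟩)
    have hd : derivAlong (Ideal.Quotient.mk (Ideal.span {Q})) (Pi.single j 1)
        (aeval f p) = 0 := by
      obtain ⟨g, hg⟩ := hdvd
      have hQ0 : Ideal.Quotient.mk (Ideal.span {Q}) Q = 0 :=
        mk_span_singleton_eq_zero_iff.mpr dvd_rfl
      rw [hp, hg, pow_two, mul_assoc, derivAlong_mul, RingHom.map_mul, hQ0]
      simp
    rw [derivAlong_aeval] at hd
    simpa [derivAlong_apply, Matrix.vecMul, dotProduct, Pi.single_apply] using hd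
  have hdvd' : ∀ i, p ∣ pderiv i p := by
    intro i
    have hi := mk_span_singleton_eq_zero_iff.mp (congrFun hw i)
    have hmem : aeval f (pderiv i p) ∈ A := by
      rw [hA, Algebra.adjoin_range_eq_range_aeval]
      exact ⟨_, rfl⟩
    have h1 : (⟨_, hmem⟩ : A) ∈ Ideal.span {P} := by
      rw [← hcomap]
      exact mem_comap_span_singleton.mpr hi
    obtain ⟨c, hc⟩ := Ideal.mem_span_singleton.mp h1
    obtain ⟨q, hq⟩ := exists_aeval_eq_of_mem hA c
    refine ⟨q, (algebraicIndependent_iff_injective_aeval.mp hf) ?_⟩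
    rw [map_mul, hp, hq]
    exact congrArg Subtype.val hc
  have hconst := eq_C_of_dvd_pderiv hdvd'
  have hPc : P = algebraMap ℂ A (coeff 0 p) := by
    apply Subtype.ext
    rw [← hp, hconst]
    simp [algebraMap_eq]
  have hc0 : coeff 0 p ≠ 0 := by
    intro h0
    rw [h0, map_zero] at hPc
    exact hP.ne_zero hPc
  exact hP.not_isUnit (hPc ▸ (isUnit_iff_ne_zero.mpr hc0).map (algebraMap ℂ A))

theorem derivAlong_polynomial_aeval {R : Type*} [CommRing R]
    (φ : MvPolynomial (Fin n) ℂ →+* R) (v : Fin n → R)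
    (hv : ∀ a : A, derivAlong φ v (a : MvPolynomial (Fin n) ℂ) = 0)
    (b : MvPolynomial (Fin n) ℂ) (p : Polynomial A) :
    derivAlong φ v (Polynomial.aeval b p) =
      φ (Polynomial.aeval b p.derivative) * derivAlong φ v b := by
  induction p using Polynomial.induction_on with
  | C a => simpa using hv a
  | add p q hp hq => simp only [map_add, hp, hq, add_mul]
  | monomial m a ih =>
    have hX : ∀ q : Polynomial A, derivAlong φ v (Polynomial.aeval b q) =
        φ (Polynomial.aeval b q.derivative) * derivAlong φ v b →
        derivAlong φ v (Polynomial.aeval b (q * Polynomial.X)) =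
        φ (Polynomial.aeval b (q * Polynomial.X).derivative) * derivAlong φ v b := by
      intro q hq
      simp only [map_mul, Polynomial.aeval_X, derivAlong_mul, hq, Polynomial.derivative_mul,
        Polynomial.derivative_X, map_add, mul_one]
      ring
    rw [pow_succ, ← mul_assoc]
    exact hX _ ih

theorem derivAlong_eq_zero_of_dvd [Module.Finite A (MvPolynomial (Fin n) ℂ)]
    {Q : MvPolynomial (Fin n) ℂ} (hQ : Irreducible Q)
    (v : Fin n → MvPolynomial (Fin n) ℂ ⧸ Ideal.span {Q})
    (hv : ∀ a : A, derivAlong (Ideal.Quotient.mk (Ideal.span {Q})) v a = 0)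
    (hvQ : ∀ g, Q ∣ g → derivAlong (Ideal.Quotient.mk (Ideal.span {Q})) v g = 0)
    (b : MvPolynomial (Fin n) ℂ) :
    derivAlong (Ideal.Quotient.mk (Ideal.span {Q})) v b = 0 := by
  have hQI : (Ideal.span {Q}).IsPrime :=
    (Ideal.span_singleton_prime hQ.ne_zero).mpr hQ.prime
  have hex : ∃ m, ∃ p : Polynomial A, p.natDegree ≤ m ∧
      ¬ Q ∣ (p.coeff m : MvPolynomial (Fin n) ℂ) ∧ Q ∣ Polynomial.aeval b p := by
    obtain ⟨p, hp, hpb⟩ := Algebra.IsIntegral.isIntegral (R := A) b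
    refine ⟨p.natDegree, p, le_rfl, ?_, ?_⟩
    · rw [Polynomial.coeff_natDegree, hp.leadingCoeff]
      exact fun h => hQ.not_isUnit (isUnit_of_dvd_one h)
    · rw [Polynomial.aeval_def, hpb]
      exact dvd_zero Q
  classical
  obtain ⟨p, hdeg, hcoeff, hpb⟩ := Nat.find_spec hex
  have hmin := fun k hk => Nat.find_min hex (m := k) hk
  generalize Nat.find hex = m at *
  cases m with
  | zero =>
    rw [Polynomial.eq_C_of_natDegree_le_zero hdeg, Polynomial.aeval_C] at hpb
    exact absurd hpb hcoeff
  | succ k =>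
    have hder : ¬ Q ∣ Polynomial.aeval b p.derivative := by
      intro hdvd
      refine hmin k k.lt_succ_self ⟨p.derivative, ?_, ?_, hdvd⟩
      · have := p.natDegree_derivative_le
        omega
      · rw [Polynomial.coeff_derivative]
        intro h
        have hu : IsUnit ((k : A) + 1) := by
          have : (k : A) + 1 = algebraMap ℂ A ((k : ℂ) + 1) := by simp
          rw [this]
          exact (isUnit_iff_ne_zero.mpr (Nat.cast_add_one_ne_zero k)).map _
        have hu' : IsUnit ((((k : A) + 1 : A)) : MvPolynomial (Fin n) ℂ) :=
          hu.map (algebraMap A (MvPolynomial (Fin n) ℂ))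
        exact hcoeff (hu'.dvd_mul_right.mp h)
    have h := hvQ _ hpb
    rw [derivAlong_polynomial_aeval _ v hv] at h
    exact (mul_eq_zero.mp h).resolve_left fun h0 => hder (mk_span_singleton_eq_zero_iff.mp h0)

theorem dvd_Jac_iff_isRamified (hA : A = Algebra.adjoin ℂ (Set.range f))
    [Module.Finite A (MvPolynomial (Fin n) ℂ)] [Module.Free A (MvPolynomial (Fin n) ℂ)]
    {Q : MvPolynomial (Fin n) ℂ} (hQ : Irreducible Q) : Q ∣ Jac f ↔ IsRamified A Q := by
  constructor
  · intro hJ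
    obtain ⟨e, P, hP, hcomap, hmult⟩ := exists_ramIdx hA hQ
    refine ⟨hQ, e, ⟨P, hP, hcomap, hmult⟩, ?_⟩
    by_contra he
    have hQI : (Ideal.span {Q}).IsPrime :=
      (Ideal.span_singleton_prime hQ.ne_zero).mpr hQ.prime
    rw [← mk_span_singleton_eq_zero_iff, map_Jac] at hJ
    obtain ⟨v, hv0, hv⟩ := Matrix.exists_mulVec_eq_zero_iff.mpr hJ
    have hvA : ∀ a : A, derivAlong (Ideal.Quotient.mk (Ideal.span {Q})) v
        (a : MvPolynomial (Fin n) ℂ) = 0 := by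
      intro a
      refine derivAlong_eq_zero_of_mem_adjoin _ v ?_ (hA.le a.2)
      rintro _ ⟨i, rfl⟩
      rw [derivAlong_eq_mulVec, hv]
      rfl
    have hQ0 : Ideal.Quotient.mk (Ideal.span {Q}) Q = 0 :=
      mk_span_singleton_eq_zero_iff.mpr dvd_rfl
    obtain ⟨R, hR⟩ : Q ∣ (P : MvPolynomial (Fin n) ℂ) :=
      mem_comap_span_singleton.mp (hcomap ▸ Ideal.mem_span_singleton_self P)
    have hnot : ¬ Q ^ 2 ∣ (P : MvPolynomial (Fin n) ℂ) := fun h =>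
      hmult.2 ((pow_dvd_pow Q (by omega)).trans h)
    have hQR : ¬ Q ∣ R := by
      rintro ⟨c, rfl⟩
      exact hnot ⟨c, by rw [hR]; ring⟩
    have hdQ : derivAlong (Ideal.Quotient.mk (Ideal.span {Q})) v Q = 0 := by
      have h := hvA P
      rw [hR, derivAlong_mul, hQ0, zero_mul, zero_add] at h
      exact (mul_eq_zero.mp h).resolve_left fun h0 => hQR (mk_span_singleton_eq_zero_iff.mp h0)
    refine hv0 (funext fun j => ?_)
    rw [← derivAlong_X (Ideal.Quotient.mk (Ideal.span {Q})) v j]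
    refine derivAlong_eq_zero_of_dvd hQ v hvA ?_ (X j)
    rintro _ ⟨g, rfl⟩
    rw [derivAlong_mul, hQ0, hdQ, zero_mul, mul_zero, add_zero]
  · rintro ⟨-, e, ⟨P, hP, hcomap, hmult⟩, he⟩
    exact dvd_Jac_of_sq_dvd hA hQ hP hcomap ((pow_dvd_pow Q he).trans hmult.1)

end ramification

/-! ### The discriminant -/

section discriminant

theorem mem_of_associated {σ : Type} {A : Subalgebra ℂ (MvPolynomial σ ℂ)}
    {g h : MvPolynomial σ ℂ} (hgh : Associated g h) (hg : g ∈ A) : h ∈ A := by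
  obtain ⟨u, rfl⟩ := hgh
  obtain ⟨c, -, hc⟩ := MvPolynomial.isUnit_iff_eq_C_of_isReduced.mp u.isUnit
  rw [hc]
  exact mul_mem hg (A.algebraMap_mem c)

theorem associated_prod_pow_of_multIs {σ : Type} {P : MvPolynomial σ ℂ} (hP : P ≠ 0)
    {T : Finset (MvPolynomial σ ℂ)} {e : MvPolynomial σ ℂ → ℕ}
    (hirr : ∀ Q ∈ T, Irreducible Q) (hmult : ∀ Q ∈ T, MultIs Q P (e Q))
    (hT : ∀ Q ∈ T, ∀ Q' ∈ T, Q ≠ Q' → ¬ Associated Q Q')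
    (hex : ∀ Q, Irreducible Q → Q ∣ P → ∃ Q' ∈ T, Associated Q Q') :
    Associated (∏ Q ∈ T, Q ^ e Q) P := by
  have hdvd : ∏ Q ∈ T, Q ^ e Q ∣ P := by
    refine Finset.prod_dvd_of_isRelPrime (fun Q hQ Q' hQ' hne => ?_) fun Q hQ => (hmult Q hQ).1
    refine IsRelPrime.pow ((hirr Q hQ).isRelPrime_iff_not_dvd.mpr fun h => ?_)
    exact hT Q hQ Q' hQ' hne ((hirr Q hQ).associated_of_dvd (hirr Q' hQ') h)
  obtain ⟨R, hR⟩ := hdvd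
  by_cases hu : IsUnit R
  · rw [hR]
    exact (associated_mul_unit_right _ R hu)
  · exfalso
    have hR0 : R ≠ 0 := by
      rintro rfl
      exact hP (by rw [hR, mul_zero])
    obtain ⟨q, hq, hqR⟩ := WfDvdMonoid.exists_irreducible_factor hu hR0
    obtain ⟨Q, hQ, hqQ⟩ := hex q hq (hqR.trans ⟨_, by rw [hR, mul_comm]⟩)
    refine (hmult Q hQ).2 ?_
    rw [hR, pow_succ]
    exact mul_dvd_mul (Finset.dvd_prod_of_mem _ hQ) (hqQ.dvd_iff_dvd_left.mp hqR)

theorem MultIs.of_associated {σ : Type} {Q P P' : MvPolynomial σ ℂ} {e : ℕ}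
    (h : MultIs Q P e) (hP : Associated P P') : MultIs Q P' e :=
  ⟨hP.dvd_iff_dvd_right.mp h.1, fun h' => h.2 (hP.dvd_iff_dvd_right.mpr h')⟩

theorem exists_irreducible_dvd_eval_eq_zero {σ : Type} {g : MvPolynomial σ ℂ} (hg : g ≠ 0)
    {x : σ → ℂ} (hx : eval x g = 0) : ∃ Q, Irreducible Q ∧ Q ∣ g ∧ eval x Q = 0 := by
  obtain ⟨s, hs, hsg⟩ := UniqueFactorizationMonoid.exists_prime_factors g hg
  have h0 : eval x s.prod = 0 := by
    obtain ⟨c, hc⟩ := hsg.symm.dvd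
    rw [hc, map_mul, hx, zero_mul]
  rw [map_multiset_prod, Multiset.prod_eq_zero_iff, Multiset.mem_map] at h0
  obtain ⟨Q, hQ, hQx⟩ := h0
  exact ⟨Q, (hs Q hQ).irreducible, (Multiset.dvd_prod hQ).trans hsg.dvd, hQx⟩

variable {n : ℕ} {f : Fin n → MvPolynomial (Fin n) ℂ}
  {A : Subalgebra ℂ (MvPolynomial (Fin n) ℂ)}

theorem eval_eq_of_mem_of_polyMap_eq (hA : A = Algebra.adjoin ℂ (Set.range f))
    {a : MvPolynomial (Fin n) ℂ} (ha : a ∈ A) {x y : Fin n → ℂ}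
    (hxy : polyMap f y = polyMap f x) : eval y a = eval x a := by
  have hy : y ∈ zeroLocus ℂ (fibreIdeal f x) := by
    rw [zeroLocus_fibreIdeal]
    exact hxy
  have := hy _ (sub_C_eval_mem_fibreIdeal f x (hA.le ha))
  simpa [aeval_eq_eval, sub_eq_zero] using this

theorem eval_Jac_eq_zero_iff (hn : 0 < n) (hA : A = Algebra.adjoin ℂ (Set.range f))
    [Module.Finite A (MvPolynomial (Fin n) ℂ)] [Module.Free A (MvPolynomial (Fin n) ℂ)]
    {S : Finset (MvPolynomial (Fin n) ℂ)} {e : MvPolynomial (Fin n) ℂ → ℕ}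
    (hS : RamReps A S e) (x : Fin n → ℂ) :
    eval x (Jac f) = 0 ↔ eval x (∏ Q ∈ S, Q ^ e Q) = 0 := by
  rw [map_prod, Finset.prod_eq_zero_iff]
  constructor
  · intro hJ
    obtain ⟨g, hg0, hgx, hgJ⟩ : ∃ g : MvPolynomial (Fin n) ℂ, g ≠ 0 ∧ eval x g = 0 ∧
        g ∣ Jac f := by
      by_cases hJ0 : Jac f = 0
      · refine ⟨X ⟨0, hn⟩ - C (x ⟨0, hn⟩), fun h => ?_, by simp, hJ0 ▸ dvd_zero _⟩
        have := congrArg (eval fun _ => x ⟨0, hn⟩ + 1) h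
        simp at this
      · exact ⟨Jac f, hJ0, hJ, dvd_rfl⟩
    obtain ⟨Q, hQ, hQg, hQx⟩ := exists_irreducible_dvd_eval_eq_zero hg0 hgx
    obtain ⟨Q', ⟨hQ'S, hass⟩, -⟩ :=
      hS.2.2 Q ((dvd_Jac_iff_isRamified hA hQ).mp (hQg.trans hgJ))
    refine ⟨Q', hQ'S, ?_⟩
    obtain ⟨c, hc⟩ := hass.dvd
    have hQ'x : eval x Q' = 0 := by rw [hc, map_mul, hQx, zero_mul]
    rw [map_pow, hQ'x, zero_pow (zero_lt_one.trans (hS.1 Q' hQ'S).2.2).ne']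
  · rintro ⟨Q, hQS, hQx⟩
    obtain ⟨hQ, hram, he⟩ := hS.1 Q hQS
    obtain ⟨c, hc⟩ := (dvd_Jac_iff_isRamified hA hQ).mpr ⟨hQ, _, hram, he⟩
    rw [map_pow] at hQx
    rw [hc, map_mul, eq_zero_of_pow_eq_zero hQx, zero_mul]

theorem exists_eval_eq_zero_of_comap_eq (hA : A = Algebra.adjoin ℂ (Set.range f))
    [Module.Finite A (MvPolynomial (Fin n) ℂ)] {Q : MvPolynomial (Fin n) ℂ} {P : A}
    (hcomap : (Ideal.span {Q}).comap (algebraMap A (MvPolynomial (Fin n) ℂ)) = Ideal.span {P})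
    {y : Fin n → ℂ} (hy : eval y (P : MvPolynomial (Fin n) ℂ) = 0) :
    ∃ x, polyMap f x = polyMap f y ∧ eval x Q = 0 := by
  have hmax : (RingHom.ker ((eval y).comp (algebraMap A (MvPolynomial (Fin n) ℂ)))).IsMaximal := by
    refine RingHom.ker_isMaximal_of_surjective _ fun c => ⟨algebraMap ℂ A c, ?_⟩
    rw [RingHom.comp_apply, ← IsScalarTower.algebraMap_apply]
    simp [algebraMap_eq]
  have hprime := hmax.isPrime
  have hPmem : P ∈ RingHom.ker ((eval y).comp (algebraMap A (MvPolynomial (Fin n) ℂ))) :=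
    RingHom.mem_ker.mpr hy
  obtain ⟨q, hqQ, hq, hqm⟩ := Ideal.exists_ideal_over_prime_of_isIntegral _ (Ideal.span {Q})
    (hcomap.le.trans ((Ideal.span_singleton_le_iff_mem _).mpr hPmem))
  have hqmax : q.IsMaximal := Ideal.isMaximal_of_isIntegral_of_isMaximal_comap q (hqm.symm ▸ hmax)
  obtain ⟨x, rfl⟩ := isMaximal_iff_eq_vanishingIdeal_singleton.mp hqmax
  refine ⟨x, funext fun i => ?_, ?_⟩
  · have hmem : f i - C (eval y (f i)) ∈ A := by
      rw [hA]
      exact sub_mem (Algebra.subset_adjoin ⟨i, rfl⟩) (Subalgebra.algebraMap_mem _ _)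
    have h : (⟨_, hmem⟩ : A) ∈
        (vanishingIdeal ℂ {x}).comap (algebraMap A (MvPolynomial (Fin n) ℂ)) := by
      rw [hqm, RingHom.mem_ker]
      change eval y (f i - C (eval y (f i))) = 0
      simp
    have h' : f i - C (eval y (f i)) ∈ vanishingIdeal ℂ {x} := h
    rw [mem_vanishingIdeal_singleton_iff] at h'
    simpa [polyMap, aeval_eq_eval, sub_eq_zero] using h'
  · have h := hqQ (Ideal.mem_span_singleton_self Q)
    rwa [mem_vanishingIdeal_singleton_iff] at h

theorem dvd_Jac_of_dvd_of_saturated (hA : A = Algebra.adjoin ℂ (Set.range f))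
    [Module.Finite A (MvPolynomial (Fin n) ℂ)]
    (hsat : ∀ x y, polyMap f x = polyMap f y → eval x (Jac f) = 0 → eval y (Jac f) = 0)
    {Q Q' : MvPolynomial (Fin n) ℂ} (hQ : Q ∣ Jac f) (hQ' : Irreducible Q') {P : A}
    (hcomap : (Ideal.span {Q}).comap (algebraMap A (MvPolynomial (Fin n) ℂ)) = Ideal.span {P})
    (hdvd : Q' ∣ (P : MvPolynomial (Fin n) ℂ)) : Q' ∣ Jac f := by
  have hQI : (Ideal.span {Q'}).IsPrime :=
    (Ideal.span_singleton_prime hQ'.ne_zero).mpr hQ'.prime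
  rw [← Ideal.mem_span_singleton, ← IsPrime.vanishingIdeal_zeroLocus (K := ℂ) (Ideal.span {Q'}),
    mem_vanishingIdeal_iff]
  intro y hy
  have hyQ' : eval y Q' = 0 := hy Q' (Ideal.mem_span_singleton_self Q')
  obtain ⟨c, hc⟩ := hdvd
  obtain ⟨x, hxy, hx⟩ := exists_eval_eq_zero_of_comap_eq hA hcomap (y := y)
    (by rw [hc, map_mul, hyQ', zero_mul])
  obtain ⟨d, hd⟩ := hQ
  exact hsat x y hxy (by rw [hd, map_mul, hx, zero_mul])

theorem discriminant_mem_of_saturated (hA : A = Algebra.adjoin ℂ (Set.range f))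
    [Module.Finite A (MvPolynomial (Fin n) ℂ)] [Module.Free A (MvPolynomial (Fin n) ℂ)]
    {S : Finset (MvPolynomial (Fin n) ℂ)} {e : MvPolynomial (Fin n) ℂ → ℕ}
    (hS : RamReps A S e)
    (hsat : ∀ x y, polyMap f x = polyMap f y → eval x (Jac f) = 0 → eval y (Jac f) = 0) :
    ∏ Q ∈ S, Q ^ e Q ∈ A := by
  classical
  let c : MvPolynomial (Fin n) ℂ → Ideal A := fun Q =>
    (Ideal.span {Q}).comap (algebraMap A (MvPolynomial (Fin n) ℂ))
  rw [← Finset.prod_fiberwise_of_maps_to (fun Q hQ => Finset.mem_image_of_mem c hQ)]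
  refine prod_mem fun I hI => ?_
  obtain ⟨Q₀, hQ₀S, rfl⟩ := Finset.mem_image.mp hI
  obtain ⟨hQ₀, ⟨P, hP, hcomap, hmult⟩, he⟩ := hS.1 Q₀ hQ₀S
  have hPprime : Prime P := by
    rw [← Ideal.span_singleton_prime hP.ne_zero, ← hcomap]
    have : (Ideal.span {Q₀}).IsPrime := (Ideal.span_singleton_prime hQ₀.ne_zero).mpr hQ₀.prime
    infer_instance
  have hJ : Q₀ ∣ Jac f :=
    (dvd_Jac_iff_isRamified hA hQ₀).mpr ⟨hQ₀, _, ⟨P, hP, hcomap, hmult⟩, he⟩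
  refine mem_of_associated (associated_prod_pow_of_multIs
    (fun h => hP.ne_zero (Subtype.ext h)) ?_ ?_ ?_ ?_).symm P.2
  · exact fun Q hQ => (hS.1 Q (Finset.mem_filter.mp hQ).1).1
  · intro Q hQ
    obtain ⟨hQS, hQc⟩ := Finset.mem_filter.mp hQ
    obtain ⟨-, ⟨P', -, hcomap', hmult'⟩, -⟩ := hS.1 Q hQS
    have hass : Associated P' P := by
      rw [← Ideal.span_singleton_eq_span_singleton, ← hcomap, ← hcomap']
      exact hQc
    exact hmult'.of_associated (hass.map (algebraMap A (MvPolynomial (Fin n) ℂ)))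
  · exact fun Q hQ Q' hQ' =>
      hS.2.1 Q (Finset.mem_filter.mp hQ).1 Q' (Finset.mem_filter.mp hQ').1
  · intro Q hQ hQP
    obtain ⟨Q', ⟨hQ'S, hass⟩, -⟩ := hS.2.2 Q ((dvd_Jac_iff_isRamified hA hQ).mp
      (dvd_Jac_of_dvd_of_saturated hA hsat hJ hQ hcomap hQP))
    refine ⟨Q', Finset.mem_filter.mpr ⟨hQ'S, ?_⟩, hass⟩
    change (Ideal.span {Q'}).comap _ = (Ideal.span {Q₀}).comap _
    rw [hcomap, ← comap_span_eq_span_of_dvd hQ hPprime hQP,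
      Ideal.span_singleton_eq_span_singleton.mpr hass]

end discriminant

end

open MvPolynomial in
theorem discriminant_mem_iff_preimage_branch_eq_ramification {n : ℕ} (hn : 0 < n)
    (b : Fin n → ℕ) (hb : ∀ i, 0 < b i) (a : Fin n → ℕ)
    (f : Fin n → MvPolynomial (Fin n) ℂ)
    (hhom : ∀ i, IsWeightedHomogeneous b (f i) (a i))
    (A : Subalgebra ℂ (MvPolynomial (Fin n) ℂ))
    (hA : A = Algebra.adjoin ℂ (Set.range f))
    (hfin : Module.Finite A (MvPolynomial (Fin n) ℂ))
    (hfree : Module.Free A (MvPolynomial (Fin n) ℂ))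
    (r : ℕ) (hr : Module.finrank A (MvPolynomial (Fin n) ℂ) = r)
    (S : Finset (MvPolynomial (Fin n) ℂ)) (eIdx : MvPolynomial (Fin n) ℂ → ℕ)
    (hS : RamReps A S eIdx) :
    (∏ Q ∈ S, Q ^ eIdx Q) ∈ A ↔
      polyMap f ⁻¹' branchLocus f r = {x | eval x (Jac f) = 0} := by
  subst hr
  have hbranch := preimage_branchLocus f A hA
  constructor
  · intro hD
    ext x
    rw [hbranch]
    refine ⟨fun ⟨y, hyx, hy⟩ => ?_, fun hx => ⟨x, rfl, hx⟩⟩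
    rw [eval_Jac_eq_zero_iff hn hA hS] at hy
    rw [Set.mem_ofPred_eq, eval_Jac_eq_zero_iff hn hA hS, ← hy]
    exact (eval_eq_of_mem_of_polyMap_eq hA hD hyx).symm
  · intro h
    refine discriminant_mem_of_saturated hA hS fun x y hxy hx => ?_
    have hy := (hbranch y).mpr ⟨x, hxy, hx⟩
    rwa [h] at hy
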